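/- arXiv:2107.09417 — 2 statements merged into one kernel-verified Lean document; each statement's English description precedes it below -/
import Mathlib

section
/- Among the 9! = 362880 permutations of [3] × [3], exactly 129600 are mapped by G to the unique maximal configuration with 8 occupied lots, and exactly 25920 are mapped to each of the nine maximal configurations with 7 occupied lots. -/
/-- The `m × n` tract of land, 0-indexed: lot `(i, j)` with `i < m` (row, from the north/top)
and `j < n` (column, from the west). -/
def grid (m n : ℕ) : Finset (ℕ × ℕ) := Finset.range m ×ˢ Finset.range n

/-- A house at `p = (i, j)` is blocked (w.r.t. configuration `C`) if its west, east and south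
neighbours `(i, j-1)`, `(i, j+1)`, `(i+1, j)` all exist and lie in `C`.  (For `C ⊆ grid m n`,
membership in `C` already guarantees existence; only `j - 1` needs the guard `1 ≤ j`.) -/
def Blocked (C : Finset (ℕ × ℕ)) (p : ℕ × ℕ) : Prop :=
  1 ≤ p.2 ∧ (p.1, p.2 - 1) ∈ C ∧ (p.1, p.2 + 1) ∈ C ∧ (p.1 + 1, p.2) ∈ C

/-- A configuration on the `m × n` tract is permissible if it consists of lots of the tract
and no house in it is blocked. -/
def Permissible (m n : ℕ) (C : Finset (ℕ × ℕ)) : Prop :=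
  C ⊆ grid m n ∧ ∀ p ∈ C, ¬ Blocked C p

/-- A configuration is maximal if it is permissible and adding a house on any empty lot
yields an impermissible configuration. -/
def MaximalConfig (m n : ℕ) (C : Finset (ℕ × ℕ)) : Prop :=
  Permissible m n C ∧ ∀ p ∈ grid m n, p ∉ C → ¬ Permissible m n (insert p C)

open scoped Classical in
/-- The greedy sequential-building map: process the lots in the order given by the list `σ`,
adding a house whenever the resulting configuration stays permissible. -/
noncomputable def G (m n : ℕ) (σ : List (ℕ × ℕ)) : Finset (ℕ × ℕ) :=
  σ.foldl (fun C p => if Permissible m n (insert p C) then insert p C else C) ∅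

open scoped Classical in
/-- One greedy step. -/
noncomputable def gstep (C : Finset (ℕ × ℕ)) (p : ℕ × ℕ) : Finset (ℕ × ℕ) :=
  if Permissible 3 3 (insert p C) then insert p C else C

/-- Number of orderings of `R` (of size `n`) leading from `C` to `T`. -/
noncomputable def V (T : Finset (ℕ × ℕ)) : ℕ → Finset (ℕ × ℕ) → Finset (ℕ × ℕ) → ℕ
  | 0, _, C => if C = T then 1 else 0
  | n + 1, R, C => ∑ p ∈ R, V T n (R.erase p) (gstep C p)

theorem V_spec (T : Finset (ℕ × ℕ)) : ∀ (n : ℕ) (R C : Finset (ℕ × ℕ)), R.card = n →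
    ∃ S : Finset (List (ℕ × ℕ)),
      (∀ σ, σ ∈ S ↔ σ.Nodup ∧ σ.toFinset = R ∧ σ.foldl gstep C = T) ∧ S.card = V T n R C := by
  intro n
  induction n with
  | zero =>
    intro R C hR
    rw [Finset.card_eq_zero] at hR
    subst hR
    by_cases h : C = T
    · refine ⟨{[]}, ?_, by simp [V, h]⟩
      intro σ
      simp only [Finset.mem_singleton, List.toFinset_eq_empty_iff]
      constructor
      · rintro rfl; simp [h]
      · exact fun h => h.2.1
    · refine ⟨∅, ?_, by simp [V, h]⟩
      intro σ
      simp only [Finset.notMem_empty, List.toFinset_eq_empty_iff, false_iff]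
      rintro ⟨-, rfl, h2⟩
      exact h h2
  | succ n ih =>
    intro R C hR
    have key : ∀ p : ℕ × ℕ, ∃ S : Finset (List (ℕ × ℕ)), p ∈ R →
      (∀ σ, σ ∈ S ↔ σ.Nodup ∧ σ.toFinset = R.erase p ∧ σ.foldl gstep (gstep C p) = T) ∧
        S.card = V T n (R.erase p) (gstep C p) := by
      intro p
      by_cases hp : p ∈ R
      · obtain ⟨S, hS⟩ := ih (R.erase p) (gstep C p) (by rw [Finset.card_erase_of_mem hp, hR]; rfl)
        exact ⟨S, fun _ => hS⟩
      · exact ⟨∅, fun h => absurd h hp⟩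
    choose S hS using key
    refine ⟨R.biUnion fun p => (S p).image (List.cons p), ?_, ?_⟩
    · intro σ
      simp only [Finset.mem_biUnion, Finset.mem_image]
      constructor
      · rintro ⟨p, hp, τ, hτ, rfl⟩
        rw [(hS p hp).1] at hτ
        obtain ⟨h1, h2, h3⟩ := hτ
        refine ⟨?_, ?_, h3⟩
        · rw [List.nodup_cons]
          refine ⟨?_, h1⟩
          rw [← List.mem_toFinset, h2]; simp
        · rw [List.toFinset_cons, h2, Finset.insert_erase hp]
      · rintro ⟨h1, h2, h3⟩
        cases σ with
        | nil => simp at h2; subst h2; simp at hR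
        | cons p τ =>
          have hp : p ∈ R := by rw [← h2]; simp
          rw [List.nodup_cons] at h1
          refine ⟨p, hp, τ, ?_, rfl⟩
          rw [(hS p hp).1]
          refine ⟨h1.2, ?_, h3⟩
          rw [← h2, List.toFinset_cons, Finset.erase_insert]
          simpa using h1.1
    · rw [Finset.card_biUnion]
      · simp only [V]
        refine Finset.sum_congr rfl fun p hp => ?_
        rw [Finset.card_image_of_injective _ List.cons_injective, (hS p hp).2]
      · intro p _ q _ hpq
        rw [Function.onFun, Finset.disjoint_left]
        intro σ h1 h2
        simp only [Finset.mem_image] at h1 h2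
        obtain ⟨a, -, rfl⟩ := h1
        obtain ⟨b, -, h⟩ := h2
        simp only [List.cons.injEq] at h
        exact hpq h.1.symm

/-- The lot with number `k`. -/
def lot (k : ℕ) : ℕ × ℕ := (k / 3, k % 3)

theorem lot_inj {a b : ℕ} (h : lot a = lot b) : a = b := by
  simp only [lot, Prod.mk.injEq] at h; omega

/-- Decode a bit mask as a configuration. -/
def dec (m : ℕ) : Finset (ℕ × ℕ) := ((Finset.range 9).filter fun k => m.testBit k = true).image lot

theorem lot_mem_dec {m k : ℕ} : lot k ∈ dec m ↔ k < 9 ∧ m.testBit k = true := by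
  simp only [dec, Finset.mem_image, Finset.mem_filter, Finset.mem_range]
  constructor
  · rintro ⟨a, h, e⟩
    rw [← lot_inj e]; exact h
  · exact fun h => ⟨k, h, rfl⟩

theorem mem_dec_iff {m : ℕ} {p : ℕ × ℕ} : p ∈ dec m ↔ ∃ k, k < 9 ∧ m.testBit k = true ∧ lot k = p := by
  simp only [dec, Finset.mem_image, Finset.mem_filter, Finset.mem_range, and_assoc]

theorem dec_or {m k : ℕ} (hk : k < 9) : dec (m ||| 2 ^ k) = insert (lot k) (dec m) := by
  ext p
  simp only [Finset.mem_insert, mem_dec_iff, Nat.testBit_or, Nat.testBit_two_pow, Bool.or_eq_true,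
    decide_eq_true_eq]
  constructor
  · rintro ⟨a, h1, h2 | rfl, rfl⟩
    · exact Or.inr ⟨a, h1, h2, rfl⟩
    · exact Or.inl rfl
  · rintro (rfl | ⟨a, h1, h2, rfl⟩)
    · exact ⟨k, hk, Or.inr rfl, rfl⟩
    · exact ⟨a, h1, Or.inl h2, rfl⟩

theorem dec_xor {m k : ℕ} (hm : m.testBit k = true) : dec (m ^^^ 2 ^ k) = (dec m).erase (lot k) := by
  ext p
  simp only [Finset.mem_erase, mem_dec_iff, Nat.testBit_xor, Nat.testBit_two_pow]
  constructor
  · rintro ⟨a, h1, h2, rfl⟩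
    have hne : k ≠ a := by rintro rfl; simp [hm] at h2
    refine ⟨fun h => hne (lot_inj h).symm, a, h1, by simpa [hne] using h2, rfl⟩
  · rintro ⟨hne, a, h1, h2, rfl⟩
    have : k ≠ a := by rintro rfl; exact hne rfl
    exact ⟨a, h1, by simpa [this] using h2, rfl⟩

/-- Permissibility on bit masks. -/
def permB (m : ℕ) : Bool :=
  !(m.testBit 0 && m.testBit 1 && m.testBit 2 && m.testBit 4) &&
  !(m.testBit 3 && m.testBit 4 && m.testBit 5 && m.testBit 7)

theorem permB_iff (m : ℕ) : Permissible 3 3 (dec m) ↔ permB m = true := by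
  have L : ∀ k, k < 9 → (lot k ∈ dec m ↔ m.testBit k = true) := fun k hk => by
    rw [lot_mem_dec]; simp [hk]
  have hsub : dec m ⊆ grid 3 3 := by
    intro p hp
    obtain ⟨k, hk, -, rfl⟩ := mem_dec_iff.1 hp
    simp only [grid, lot, Finset.mem_product, Finset.mem_range]
    omega
  have h0 := L 0 (by norm_num)
  have h1 := L 1 (by norm_num)
  have h2 := L 2 (by norm_num)
  have h3 := L 3 (by norm_num)
  have h4 := L 4 (by norm_num)
  have h5 := L 5 (by norm_num)
  have h7 := L 7 (by norm_num)
  norm_num [lot] at h0 h1 h2 h3 h4 h5 h7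
  have hP : permB m = true ↔
      ¬ (((0, 0) ∈ dec m ∧ (0, 1) ∈ dec m ∧ (0, 2) ∈ dec m ∧ (1, 1) ∈ dec m)) ∧
      ¬ (((1, 0) ∈ dec m ∧ (1, 1) ∈ dec m ∧ (1, 2) ∈ dec m ∧ (2, 1) ∈ dec m)) := by
    rw [h0, h1, h2, h3, h4, h5, h7]
    have e0 : m % 2 = 1 ↔ m.testBit 0 = true := by simp
    rw [e0, permB]
    generalize m.testBit 0 = b0
    generalize m.testBit 1 = b1
    generalize m.testBit 2 = b2
    generalize m.testBit 3 = b3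
    generalize m.testBit 4 = b4
    generalize m.testBit 5 = b5
    generalize m.testBit 7 = b7
    revert b0 b1 b2 b3 b4 b5 b7
    decide
  rw [hP]
  constructor
  · rintro ⟨-, h⟩
    refine ⟨fun ⟨a, b, c, d⟩ => h _ b ⟨by norm_num, a, c, d⟩,
      fun ⟨a, b, c, d⟩ => h _ b ⟨by norm_num, a, c, d⟩⟩
  · rintro ⟨ha, hb⟩
    refine ⟨hsub, ?_⟩
    rintro ⟨i, j⟩ hp ⟨hj, hw, he, hs⟩
    have g1 := hsub he
    have g2 := hsub hs
    simp only [grid, Finset.mem_product, Finset.mem_range] at g1 g2 hj hw he hs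
    obtain rfl : j = 1 := by omega
    obtain rfl | rfl : i = 0 ∨ i = 1 := by omega
    · exact ha ⟨hw, hp, he, hs⟩
    · exact hb ⟨hw, hp, he, hs⟩

/-- Merge two weighted state lists (remaining mask, configuration mask, weight). -/
def mrg : ℕ → List (ℕ × ℕ × ℕ) → List (ℕ × ℕ × ℕ) → List (ℕ × ℕ × ℕ)
  | 0, l, l' => l ++ l'
  | _ + 1, [], l' => l'
  | _ + 1, l, [] => l
  | f + 1, (r, c, w) :: l, (r', c', w') :: l' =>
    bif Nat.beq r r' && Nat.beq c c' then (r, c, w + w') :: mrg f l l'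
    else bif Nat.blt (c * 512 + r) (c' * 512 + r') then (r, c, w) :: mrg f l ((r', c', w') :: l')
    else (r', c', w') :: mrg f ((r, c, w) :: l) l'

def accL (k : ℕ) : List (ℕ × ℕ × ℕ) → List (ℕ × ℕ × ℕ)
  | [] => []
  | (r, c, w) :: l =>
    bif r.testBit k && permB (c ||| 2 ^ k) then (r ^^^ 2 ^ k, c ||| 2 ^ k, w) :: accL k l
    else accL k l

def rejL (k : ℕ) : List (ℕ × ℕ × ℕ) → List (ℕ × ℕ × ℕ)
  | [] => []
  | (r, c, w) :: l =>
    bif r.testBit k && !permB (c ||| 2 ^ k) then (r ^^^ 2 ^ k, c, w) :: rejL k l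
    else rejL k l

def nextUpto (W : List (ℕ × ℕ × ℕ)) : ℕ → List (ℕ × ℕ × ℕ)
  | 0 => []
  | k + 1 => mrg 5000 (nextUpto W k) (mrg 5000 (accL k W) (rejL k W))

def run : ℕ → List (ℕ × ℕ × ℕ) → List (ℕ × ℕ × ℕ)
  | 0, W => W
  | n + 1, W => run n (nextUpto W 9)

def total (φ : ℕ → ℕ → ℕ) : List (ℕ × ℕ × ℕ) → ℕ
  | [] => 0
  | (r, c, w) :: l => w * φ r c + total φ l

theorem total_append (φ : ℕ → ℕ → ℕ) (l l' : List (ℕ × ℕ × ℕ)) :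
    total φ (l ++ l') = total φ l + total φ l' := by
  induction l with
  | nil => simp [total]
  | cons s l ih => obtain ⟨r, c, w⟩ := s; simp [total, ih, add_assoc]

theorem total_mrg (φ : ℕ → ℕ → ℕ) (f : ℕ) (l l' : List (ℕ × ℕ × ℕ)) :
    total φ (mrg f l l') = total φ l + total φ l' := by
  induction f generalizing l l' with
  | zero => simp [mrg, total_append]
  | succ f ih =>
    match l, l' with
    | [], l' => simp [mrg, total]
    | s :: l, [] => simp [mrg, total]
    | (r, c, w) :: l, (r', c', w') :: l' =>
      rw [mrg]
      cases h : (Nat.beq r r' && Nat.beq c c')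
      · cases h' : Nat.blt (c * 512 + r) (c' * 512 + r')
        · simp only [cond_false, total, ih]; ring
        · simp only [cond_false, cond_true, total, ih]; ring
      · simp only [Bool.and_eq_true] at h
        obtain ⟨h1, h2⟩ := h
        have := Nat.eq_of_beq_eq_true h1
        have := Nat.eq_of_beq_eq_true h2
        subst r' c'
        simp only [cond_true, total, ih]; ring

theorem gstep_dec {c k : ℕ} (hk : k < 9) :
    gstep (dec c) (lot k) = if permB (c ||| 2 ^ k) = true then dec (c ||| 2 ^ k) else dec c := by
  simp only [gstep, ← dec_or hk, permB_iff]

theorem total_branch (T : Finset (ℕ × ℕ)) (n k : ℕ) (hk : k < 9) (W : List (ℕ × ℕ × ℕ)) :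
    total (fun r c => V T n (dec r) (dec c)) (accL k W) +
      total (fun r c => V T n (dec r) (dec c)) (rejL k W) =
    total (fun r c => if r.testBit k = true then
      V T n ((dec r).erase (lot k)) (gstep (dec c) (lot k)) else 0) W := by
  induction W with
  | nil => rfl
  | cons s l ih =>
    obtain ⟨r, c, w⟩ := s
    simp only [accL, rejL, total, ← ih]
    cases h : r.testBit k
    · simp
    · rw [gstep_dec hk]
      cases h' : permB (c ||| 2 ^ k)
      · simp [total, dec_xor h]; ring
      · simp [total, dec_xor h]; ring

theorem total_add (φ ψ : ℕ → ℕ → ℕ) (W : List (ℕ × ℕ × ℕ)) :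
    total φ W + total ψ W = total (fun r c => φ r c + ψ r c) W := by
  induction W with
  | nil => rfl
  | cons s l ih => obtain ⟨r, c, w⟩ := s; simp only [total, ← ih]; ring

theorem total_nextUpto (T : Finset (ℕ × ℕ)) (n : ℕ) (W : List (ℕ × ℕ × ℕ)) (j : ℕ) (hj : j ≤ 9) :
    total (fun r c => V T n (dec r) (dec c)) (nextUpto W j) =
    total (fun r c => ∑ k ∈ Finset.range j, if r.testBit k = true then
      V T n ((dec r).erase (lot k)) (gstep (dec c) (lot k)) else 0) W := by
  induction j with
  | zero =>
    simp only [nextUpto, total, Finset.range_zero, Finset.sum_empty]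
    induction W with
    | nil => rfl
    | cons s l ih => obtain ⟨r, c, w⟩ := s; simp only [total, ← ih]; rfl
  | succ j ih =>
    rw [nextUpto, total_mrg, total_mrg, total_branch T n j (by omega), ih (by omega), total_add]
    simp only [Finset.sum_range_succ]

theorem V_succ_dec (T : Finset (ℕ × ℕ)) (n r c : ℕ) :
    V T (n + 1) (dec r) (dec c) = ∑ k ∈ Finset.range 9, if r.testBit k = true then
      V T n ((dec r).erase (lot k)) (gstep (dec c) (lot k)) else 0 := by
  rw [← Finset.sum_filter, V]
  conv_lhs => rw [dec]
  rw [Finset.sum_image fun a _ b _ h => lot_inj h]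
  rfl

theorem total_run (T : Finset (ℕ × ℕ)) (n : ℕ) : ∀ W : List (ℕ × ℕ × ℕ),
    total (fun r c => V T n (dec r) (dec c)) W =
    total (fun r c => V T 0 (dec r) (dec c)) (run n W) := by
  induction n with
  | zero => intro W; rfl
  | succ n ih =>
    intro W
    rw [run, ← ih, total_nextUpto T n W 9 le_rfl]
    simp only [V_succ_dec]

theorem dec_full : dec 511 = grid 3 3 := by decide +kernel
theorem dec_zero : dec 0 = ∅ := by decide +kernel

theorem count_eq (T : Finset (ℕ × ℕ)) :
    {σ : List (ℕ × ℕ) | σ.Nodup ∧ σ.toFinset = grid 3 3 ∧ G 3 3 σ = T}.ncard =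
    total (fun _ c => if dec c = T then 1 else 0) (run 9 [(511, 0, 1)]) := by
  obtain ⟨S, hS, hc⟩ := V_spec T 9 (grid 3 3) ∅ (by decide +kernel)
  have : {σ : List (ℕ × ℕ) | σ.Nodup ∧ σ.toFinset = grid 3 3 ∧ G 3 3 σ = T} = ↑S := by
    ext σ
    rw [Finset.mem_coe, hS]
    rfl
  rw [this, Set.ncard_coe_finset, hc]
  have h := total_run T 9 [(511, 0, 1)]
  simp only [total, dec_full, dec_zero, one_mul, add_zero] at h
  rw [h]
  rfl

/-- The final weighted states. -/
def finalStates : List (ℕ × ℕ × ℕ) :=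
  [(0, 379, 25920), (0, 381, 25920), (0, 382, 25920), (0, 475, 25920), (0, 477, 25920), (0, 478, 25920), (0, 495, 129600), (0, 499, 25920), (0, 501, 25920), (0, 502, 25920)]

theorem run_eq : run 9 [(511, 0, 1)] = finalStates := by
  decide +kernel

instance (C : Finset (ℕ × ℕ)) (p : ℕ × ℕ) : Decidable (Blocked C p) := by
  unfold Blocked; infer_instance

instance (m n : ℕ) (C : Finset (ℕ × ℕ)) : Decidable (Permissible m n C) := by
  unfold Permissible; infer_instance

instance (m n : ℕ) (C : Finset (ℕ × ℕ)) : Decidable (MaximalConfig m n C) := by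
  unfold MaximalConfig; infer_instance

theorem final_check : ∀ T ∈ (grid 3 3).powerset,
    (T.card = 8 → MaximalConfig 3 3 T →
      total (fun _ c => if dec c = T then 1 else 0) finalStates = 129600) ∧
    (T.card = 7 → MaximalConfig 3 3 T →
      total (fun _ c => if dec c = T then 1 else 0) finalStates = 25920) := by
  decide +kernel

/-- Of the `9! = 362880` permutations of the lots of the 3 × 3 tract, exactly 129600 map
under `G` to the unique maximal configuration with 8 houses, and exactly 25920 map to each
of the nine maximal configurations with 7 houses. -/
theorem stmt_14 (C : Finset (ℕ × ℕ)) (hC : MaximalConfig 3 3 C) :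
    (C.card = 8 →
      {σ : List (ℕ × ℕ) | σ.Nodup ∧ σ.toFinset = grid 3 3 ∧ G 3 3 σ = C}.ncard = 129600) ∧
    (C.card = 7 →
      {σ : List (ℕ × ℕ) | σ.Nodup ∧ σ.toFinset = grid 3 3 ∧ G 3 3 σ = C}.ncard = 25920) := by
  have hT : C ∈ (grid 3 3).powerset := Finset.mem_powerset.2 hC.1.1
  have h := final_check C hT
  rw [count_eq, run_eq]
  exact ⟨fun h8 => h.1 h8 hC, fun h7 => h.2 h7 hC⟩
end

section
/- For every maximal configuration C on a 3 × 3 tract of land, the number of permutations σ ∈ S_{[3]×[3]} with G(σ) = C is at least 25920; equivalently, every maximal configuration on [3] × [3] is reached by the sequential building process with probability at least 25920/362880 = 1/14. -/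
open scoped Classical in
/-- `x` is the last element of `σ` lying in `Q`. -/
def LastIn (Q : Finset (ℕ × ℕ)) (x : ℕ × ℕ) (σ : List (ℕ × ℕ)) : Prop :=
  (σ.filter (fun q => decide (q ∈ Q))).getLast? = some x

/-- The top forbidden pattern. -/
def QA : Finset (ℕ × ℕ) := {(0,0), (0,2), (1,1), (0,1)}
/-- The bottom forbidden pattern. -/
def QB : Finset (ℕ × ℕ) := {(1,0), (1,2), (2,1), (1,1)}

theorem perm_iff (C : Finset (ℕ × ℕ)) :
    Permissible 3 3 C ↔ C ⊆ grid 3 3 ∧ ¬ QA ⊆ C ∧ ¬ QB ⊆ C := by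
  unfold Permissible
  refine and_congr_right fun hC => ?_
  constructor
  · intro h
    refine ⟨fun hq => ?_, fun hq => ?_⟩
    · exact h (0,1) (hq (by decide)) ⟨by decide, hq (by decide), hq (by decide), hq (by decide)⟩
    · exact h (1,1) (hq (by decide)) ⟨by decide, hq (by decide), hq (by decide), hq (by decide)⟩
  · rintro ⟨hA, hB⟩ ⟨i, j⟩ hp ⟨h1, h2, h3, h4⟩
    have e3 := hC h3
    have e4 := hC h4
    simp only [grid, Finset.mem_product, Finset.mem_range] at e3 e4 h1 h2 h3 h4
    have hj : j = 1 := by omega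
    subst hj
    have hi : i = 0 ∨ i = 1 := by omega
    rcases hi with rfl | rfl
    · apply hA; intro q hq
      simp only [QA, Finset.mem_insert, Finset.mem_singleton] at hq
      rcases hq with rfl | rfl | rfl | rfl <;> assumption
    · apply hB; intro q hq
      simp only [QB, Finset.mem_insert, Finset.mem_singleton] at hq
      rcases hq with rfl | rfl | rfl | rfl <;> assumption

theorem perm_mono {C D : Finset (ℕ × ℕ)} (h : C ⊆ D) (hD : Permissible 3 3 D) :
    Permissible 3 3 C := by
  rw [perm_iff] at *
  exact ⟨h.trans hD.1, fun k => hD.2.1 (k.trans h), fun k => hD.2.2 (k.trans h)⟩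

theorem max_eq {C D : Finset (ℕ × ℕ)} (hC : MaximalConfig 3 3 C) (h : C ⊆ D)
    (hD : Permissible 3 3 D) : C = D := by
  refine h.antisymm fun p hp => ?_
  by_contra hpC
  exact hC.2 p (hD.1 hp) hpC (perm_mono (Finset.insert_subset hp h) hD)

theorem last_prefix {Q : Finset (ℕ × ℕ)} {p : ℕ × ℕ} {l r : List (ℕ × ℕ)}
    (hn : (l ++ p :: r).Nodup) (h : LastIn Q p (l ++ p :: r)) :
    ∀ q ∈ Q, q ≠ p → q ∈ l ++ p :: r → q ∈ l := by
  intro q hq hqp hm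
  rw [List.mem_append, List.mem_cons] at hm
  rcases hm with hm | hm | hm
  · exact hm
  · exact absurd hm hqp
  · exfalso
    have hf : r.filter (fun q => decide (q ∈ Q)) ≠ [] :=
      List.ne_nil_of_mem (List.mem_filter.2 ⟨hm, by simpa using hq⟩)
    have hp : p ∈ r := by
      unfold LastIn at h
      have : l ++ p :: r = (l ++ [p]) ++ r := by simp
      rw [this, List.filter_append, List.getLast?_append_of_ne_nil _ hf] at h
      exact (List.mem_filter.1 (List.mem_of_getLast? h)).1
    have h2 := (List.nodup_append.1 hn).2.1
    exact (List.nodup_cons.1 h2).1 hp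

theorem G_eq {C : Finset (ℕ × ℕ)} (hC : Permissible 3 3 C) {σ : List (ℕ × ℕ)} (hn : σ.Nodup)
    (hσ : σ.toFinset = grid 3 3)
    (h : ∀ p ∈ grid 3 3, p ∉ C → ∃ Q, (Q = QA ∨ Q = QB) ∧ (∀ q ∈ Q, q ≠ p → q ∈ C) ∧
      LastIn Q p σ) : G 3 3 σ = C := by
  classical
  have key : ∀ l r : List (ℕ × ℕ), l ++ r = σ → G 3 3 l = l.toFinset ∩ C := by
    intro l
    induction l using List.reverseRecOn with
    | nil => intro r _; simp [G]
    | append_singleton l p ih =>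
      intro r hr
      have hr' : l ++ p :: r = σ := by simpa using hr
      have ih' := ih _ hr'
      unfold G at ih' ⊢
      rw [List.foldl_append, ih', List.foldl_cons, List.foldl_nil]
      have hpg : p ∈ grid 3 3 := by rw [← hσ, ← hr']; simp
      by_cases hp : p ∈ C
      · rw [if_pos]
        · ext x; simp only [Finset.mem_insert, Finset.mem_inter, List.mem_toFinset,
            List.mem_append, List.mem_singleton]
          constructor
          · rintro (rfl | h)
            · exact ⟨Or.inr rfl, hp⟩
            · exact ⟨Or.inl h.1, h.2⟩
          · rintro ⟨h | h, h'⟩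
            · exact Or.inr ⟨h, h'⟩
            · exact Or.inl h
        · exact perm_mono (Finset.insert_subset hp Finset.inter_subset_right) hC
      · rw [if_neg]
        · ext x; simp only [Finset.mem_inter, List.mem_toFinset,
            List.mem_append, List.mem_singleton]
          constructor
          · rintro ⟨h, h'⟩; exact ⟨Or.inl h, h'⟩
          · rintro ⟨h | rfl, h'⟩
            · exact ⟨h, h'⟩
            · exact absurd h' hp
        · obtain ⟨Q, hQ, hQC, hL⟩ := h p hpg hp
          have hQg : Q ⊆ grid 3 3 := by
            rcases hQ with rfl | rfl <;> decide
          rw [← hr'] at hn hL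
          have hpre := last_prefix hn hL
          have hsub : Q ⊆ insert p (l.toFinset ∩ C) := by
            intro q hq
            by_cases hqp : q = p
            · simp [hqp]
            · have : q ∈ l ++ p :: r := by
                rw [hr', ← List.mem_toFinset, hσ]; exact hQg hq
              simp [hpre q hq hqp this, hQC q hq hqp]
          rw [perm_iff]
          rintro ⟨-, h1, h2⟩
          rcases hQ with rfl | rfl
          · exact h1 hsub
          · exact h2 hsub
  rw [key σ [] (by simp), hσ]
  exact Finset.inter_eq_right.2 hC.1

/-- All orders of building. -/
def X : Set (List (ℕ × ℕ)) := {σ | σ.Nodup ∧ σ.toFinset = grid 3 3}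

theorem X_eq : X = {σ | σ ∈ (grid 3 3).toList.permutations} := by
  ext σ
  simp only [X, Set.mem_ofPred_eq, List.mem_permutations]
  constructor
  · rintro ⟨h1, h2⟩
    rw [List.perm_ext_iff_of_nodup h1 (Finset.nodup_toList _)]
    intro a; rw [Finset.mem_toList, ← h2, List.mem_toFinset]
  · intro h
    refine ⟨h.nodup_iff.2 (Finset.nodup_toList _), ?_⟩
    ext a; rw [List.mem_toFinset, h.mem_iff, Finset.mem_toList]

theorem X_eq' : X = ((grid 3 3).toList.permutations.toFinset : Set (List (ℕ × ℕ))) := by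
  rw [X_eq]; ext; simp

theorem X_card : X.ncard = 362880 := by
  rw [X_eq', Set.ncard_coe_finset,
    List.toFinset_card_of_nodup (List.nodup_permutations _ (Finset.nodup_toList _)),
    List.length_permutations, Finset.length_toList]
  rfl

theorem X_fin : X.Finite := by
  rw [X_eq']; exact Finset.finite_toSet _

theorem X_swap {σ : List (ℕ × ℕ)} (h : σ ∈ X) {x a : ℕ × ℕ} (hx : x ∈ grid 3 3)
    (ha : a ∈ grid 3 3) : σ.map (Equiv.swap x a) ∈ X := by
  refine ⟨h.1.map (Equiv.injective _), ?_⟩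
  have h2 := h.2
  ext q
  rw [List.mem_toFinset, List.mem_map]
  have hs : ∀ q, q ∈ grid 3 3 → Equiv.swap x a q ∈ grid 3 3 := by
    intro q hq
    rw [Equiv.swap_apply_def]; split_ifs <;> assumption
  constructor
  · rintro ⟨p, hp, rfl⟩
    exact hs _ (by rw [← h2]; simpa using hp)
  · intro hq
    refine ⟨Equiv.swap x a q, ?_, by simp⟩
    rw [← List.mem_toFinset, h2]; exact hs _ hq

theorem last_swap {Q : Finset (ℕ × ℕ)} {σ : List (ℕ × ℕ)} {p x a : ℕ × ℕ} (h : LastIn Q p σ)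
    (hxa : x ∈ Q ↔ a ∈ Q) : LastIn Q (Equiv.swap x a p) (σ.map (Equiv.swap x a)) := by
  unfold LastIn at *
  rw [List.filter_map, List.getLast?_map]
  have : ((fun q => decide (q ∈ Q)) ∘ (Equiv.swap x a)) = (fun q => decide (q ∈ Q)) := by
    funext q
    simp only [Function.comp, decide_eq_decide]
    rw [Equiv.swap_apply_def]; split_ifs with h1 h2
    · subst h1; exact hxa.symm
    · subst h2; exact hxa
    · rfl
  rw [this, h]; rfl

theorem exists_last {Q : Finset (ℕ × ℕ)} (hQ : Q ⊆ grid 3 3) (hne : Q.Nonempty)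
    {σ : List (ℕ × ℕ)} (h : σ ∈ X) : ∃ x ∈ Q, LastIn Q x σ := by
  classical
  obtain ⟨q, hq⟩ := hne
  have hm : q ∈ σ := by rw [← List.mem_toFinset, h.2]; exact hQ hq
  have hf : σ.filter (fun q => decide (q ∈ Q)) ≠ [] :=
    List.ne_nil_of_mem (List.mem_filter.2 ⟨hm, by simpa using hq⟩)
  have e := List.getLast?_eq_some_getLast hf
  refine ⟨_, ?_, by unfold LastIn; convert e⟩
  simpa using (List.mem_filter.1 (List.getLast_mem hf)).2

theorem swap_map (x a : ℕ × ℕ) (σ : List (ℕ × ℕ)) :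
    (σ.map (Equiv.swap x a)).map (Equiv.swap x a) = σ := by
  rw [List.map_map]
  have : (Equiv.swap x a : ℕ × ℕ → ℕ × ℕ) ∘ (Equiv.swap x a) = id := by funext; simp
  rw [this, List.map_id]

/-- Counting one last element. -/
theorem count_one {S : Set (List (ℕ × ℕ))} (hSX : S ⊆ X) {Q : Finset (ℕ × ℕ)}
    (hQ : Q ⊆ grid 3 3) {a : ℕ × ℕ} (ha : a ∈ Q)
    {T : Set (List (ℕ × ℕ))} (hT : T.Finite)
    (hST : ∀ σ ∈ S, ∀ x ∈ Q, LastIn Q x σ → σ.map (Equiv.swap x a) ∈ T) :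
    S.ncard ≤ T.ncard * Q.card := by
  classical
  have : ∀ σ : List (ℕ × ℕ), ∃ x, σ ∈ S → x ∈ Q ∧ LastIn Q x σ := by
    intro σ
    by_cases h : σ ∈ S
    · obtain ⟨x, h1, h2⟩ := exists_last hQ ⟨a, ha⟩ (hSX h)
      exact ⟨x, fun _ => ⟨h1, h2⟩⟩
    · exact ⟨a, fun k => absurd k h⟩
  choose f hf using this
  rw [← Set.ncard_coe_finset Q, ← Set.ncard_prod]
  refine Set.ncard_le_ncard_of_injOn (fun σ => (σ.map (Equiv.swap (f σ) a), f σ)) ?_ ?_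
    (hT.prod (Finset.finite_toSet _))
  · intro σ hσ
    exact ⟨hST σ hσ _ (hf σ hσ).1 (hf σ hσ).2, (hf σ hσ).1⟩
  · intro σ _ τ _ h
    simp only [Prod.mk.injEq] at h
    rw [← swap_map (f σ) a σ, h.1, h.2, swap_map]

/-- Counting orders with `a` last overall and `b` last in `Q`. -/
theorem count_two {Q R : Finset (ℕ × ℕ)} (hR : R ⊆ grid 3 3) (hQR : Q ⊆ R) {a b : ℕ × ℕ}
    (ha : a ∈ R) (haQ : a ∉ Q) (hb : b ∈ Q) (hc : R.card = 7) (hc' : Q.card = 4) :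
    12960 ≤ {σ | σ ∈ X ∧ LastIn R a σ ∧ LastIn Q b σ}.ncard := by
  have h1 := count_one (S := X) subset_rfl hR ha (T := {σ | σ ∈ X ∧ LastIn R a σ})
    (X_fin.subset fun _ h => h.1) (by
      intro σ hσ x hx hL
      refine ⟨X_swap hσ (hR hx) (hR ha), ?_⟩
      have := last_swap (a := a) (x := x) hL (by simp [hx, ha])
      simpa using this)
  have h2 := count_one (S := {σ | σ ∈ X ∧ LastIn R a σ}) (fun _ h => h.1) (hQR.trans hR) hb
    (T := {σ | σ ∈ X ∧ LastIn R a σ ∧ LastIn Q b σ})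
    (X_fin.subset fun _ h => h.1) (by
      intro σ hσ x hx hL
      refine ⟨X_swap hσ.1 (hR (hQR hx)) (hR (hQR hb)), ?_, ?_⟩
      · have := last_swap (a := b) (x := x) hσ.2 (by simp [hQR hx, hQR hb])
        rwa [Equiv.swap_apply_of_ne_of_ne] at this
        · rintro rfl; exact haQ hx
        · rintro rfl; exact haQ hb
      · have := last_swap (a := b) (x := x) hL (by simp [hx, hb])
        simpa using this)
  rw [X_card] at h1
  rw [hc] at h1
  rw [hc'] at h2
  omega

/-- Every maximal configuration on the 3 × 3 tract is reached by the sequential building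
process from at least 25920 of the `9! = 362880` permutations. -/
theorem stmt_16 (C : Finset (ℕ × ℕ)) (hC : MaximalConfig 3 3 C) :
    25920 ≤ {σ : List (ℕ × ℕ) | σ.Nodup ∧ σ.toFinset = grid 3 3 ∧ G 3 3 σ = C}.ncard := by
  have hfin : {σ : List (ℕ × ℕ) | σ.Nodup ∧ σ.toFinset = grid 3 3 ∧ G 3 3 σ = C}.Finite :=
    X_fin.subset fun _ h => ⟨h.1, h.2.1⟩
  have hAg : QA ⊆ grid 3 3 := by decide
  have hBg : QB ⊆ grid 3 3 := by decide
  have hp := hC.1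
  by_cases h11 : (1,1) ∈ C
  · obtain ⟨hg, hA, hB⟩ := (perm_iff C).1 hp
    obtain ⟨a, haA, haC⟩ := Finset.not_subset.1 hA
    obtain ⟨b, hbB, hbC⟩ := Finset.not_subset.1 hB
    have hAB : ∀ q ∈ QA, q ∈ QB → q = (1,1) := by decide
    have haB : a ∉ QB := fun h => haC (hAB a haA h ▸ h11)
    have hbA : b ∉ QA := fun h => hbC (hAB b h hbB ▸ h11)
    have hCe : C = (grid 3 3 \ {a, b}) := by
      apply max_eq hC
      · intro q hq
        simp only [Finset.mem_sdiff, Finset.mem_insert, Finset.mem_singleton, not_or]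
        exact ⟨hg hq, fun h => haC (h ▸ hq), fun h => hbC (h ▸ hq)⟩
      · rw [perm_iff]
        refine ⟨Finset.sdiff_subset, fun h => ?_, fun h => ?_⟩
        · simpa using h haA
        · simpa using h hbB
    have c1 := count_two (R := QA ∪ QB) (Q := QB) (a := a) (b := b) (by decide) (by decide)
      (Finset.mem_union_left _ haA) haB hbB (by decide) (by decide)
    have c2 := count_two (R := QA ∪ QB) (Q := QA) (a := b) (b := a) (by decide) (by decide)
      (Finset.mem_union_right _ hbB) hbA haA (by decide) (by decide)
    have hshrink : ∀ {Q : Finset (ℕ × ℕ)} {x σ}, x ∈ Q → Q ⊆ QA ∪ QB → σ ∈ X →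
        LastIn (QA ∪ QB) x σ → LastIn Q x σ := by
      intro Q x σ hx hQ hσ hL
      obtain ⟨y, hy, hLy⟩ := exists_last (hQ.trans (by decide)) ⟨x, hx⟩ hσ
      by_cases hyx : y = x
      · exact hyx ▸ hLy
      · exfalso
        have hxm : x ∈ σ := by rw [← List.mem_toFinset, hσ.2]; exact (hQ.trans (by decide)) hx
        have hym : y ∈ σ := by rw [← List.mem_toFinset, hσ.2]; exact (hQ.trans (by decide)) hy
        obtain ⟨l, r, rfl⟩ := List.append_of_mem hxm
        have h1 := last_prefix hσ.1 hL y (hQ hy) hyx hym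
        obtain ⟨l1, l2, rfl⟩ := List.append_of_mem h1
        have e : l1 ++ y :: l2 ++ x :: r = l1 ++ y :: (l2 ++ x :: r) := by simp
        have hn := hσ.1
        rw [e] at hn hLy hxm
        have h2 := last_prefix hn hLy x hx (Ne.symm hyx) hxm
        exact (List.nodup_append.1 hn).2.2 x h2 x (by simp) rfl
    have hd : Disjoint {σ | σ ∈ X ∧ LastIn (QA ∪ QB) a σ ∧ LastIn QB b σ}
        {σ | σ ∈ X ∧ LastIn (QA ∪ QB) b σ ∧ LastIn QA a σ} := by
      rw [Set.disjoint_left]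
      rintro σ ⟨_, h1, _⟩ ⟨_, h2, _⟩
      unfold LastIn at h1 h2
      rw [h1] at h2
      injection h2 with h2
      exact haB (h2 ▸ hbB)
    have hu := Set.ncard_union_eq hd (X_fin.subset fun _ h => h.1) (X_fin.subset fun _ h => h.1)
    refine le_trans (by omega) (hu.symm.le.trans (Set.ncard_le_ncard ?_ hfin))
    have main : ∀ σ ∈ X, LastIn QA a σ → LastIn QB b σ → G 3 3 σ = C := by
      intro σ hσ h1 h2
      refine G_eq hp hσ.1 hσ.2 fun p hpg hpC => ?_
      have hpab : p = a ∨ p = b := by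
        by_contra hcon
        apply hpC; rw [hCe]; simpa [hpg] using hcon
      rcases hpab with rfl | rfl
      · refine ⟨QA, Or.inl rfl, fun q hq hqp => ?_, h1⟩
        rw [hCe]
        simp only [Finset.mem_sdiff, Finset.mem_insert, Finset.mem_singleton, not_or]
        exact ⟨hAg hq, hqp, fun h => hbA (h ▸ hq)⟩
      · refine ⟨QB, Or.inr rfl, fun q hq hqp => ?_, h2⟩
        rw [hCe]
        simp only [Finset.mem_sdiff, Finset.mem_insert, Finset.mem_singleton, not_or]
        exact ⟨hBg hq, fun h => haB (h ▸ hq), hqp⟩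
    rintro σ (⟨hσ, h1, h2⟩ | ⟨hσ, h1, h2⟩)
    · exact ⟨hσ.1, hσ.2, main σ hσ (hshrink haA Finset.subset_union_left hσ h1) h2⟩
    · exact ⟨hσ.1, hσ.2, main σ hσ h2 (hshrink hbB Finset.subset_union_right hσ h1)⟩
  · have hCe : C = grid 3 3 \ {(1,1)} := by
      apply max_eq hC
      · intro q hq
        simp only [Finset.mem_sdiff, Finset.mem_singleton]
        exact ⟨hp.1 hq, fun h => h11 (h ▸ hq)⟩
      · rw [perm_iff]; decide
    have h1 := count_one (S := X) subset_rfl hAg (a := (1,1)) (by decide) hfin (by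
      intro σ hσ x hx hL
      have hm := X_swap hσ (hAg hx) (a := (1,1)) (by decide)
      refine ⟨hm.1, hm.2, G_eq hp hm.1 hm.2 fun p hpg hpC => ⟨QA, Or.inl rfl, ?_⟩⟩
      have hp1 : p = (1,1) := by
        by_contra hcon
        apply hpC; rw [hCe]; simpa [hpg] using hcon
      subst hp1
      refine ⟨fun q hq hqp => ?_, ?_⟩
      · rw [hCe]; simp only [Finset.mem_sdiff, Finset.mem_singleton]
        exact ⟨hAg hq, hqp⟩
      · have := last_swap (a := (1,1)) (x := x) hL ⟨fun _ => by decide, fun _ => hx⟩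
        simpa using this)
    rw [X_card, show QA.card = 4 by decide] at h1
    omega
end
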